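/- arXiv:2407.13052 — 2 statements merged into one kernel-verified Lean document; each statement's English description precedes it below -/
import Mathlib

section
/- Let I and L be finite sets, c : L → ℕ, g : I × L → ℝ, ℓ : I → L a default assignment, and y : I → {0,1} realized outcomes; let Π_h be the set of feasible assignments π with π(i) = ℓ(i) for every i with y(i) = 1, and assume Π_h is nonempty. If g' : I × L → ℝ is such that every feasible assignment maximizing V_·(g') lies in Π_h, then ‖g' − g‖₁ ≥ V*(g) − max_{π ∈ Π_h} V_π(g). -/
/-- An assignment `π : I → L` is feasible w.r.t. capacities `c` if at most `c l`
refugees are assigned to each location `l`. -/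
def Feasible {I L : Type*} [Fintype I] [DecidableEq L] (c : L → ℕ) (π : I → L) : Prop :=
  ∀ l : L, (Finset.univ.filter fun i => π i = l).card ≤ c l

/-- The value `V_π(g) = ∑ i, g (i, π i)` of an assignment `π` under weights `g`. -/
def assignVal {I L : Type*} [Fintype I] (g : I → L → ℝ) (π : I → L) : ℝ :=
  ∑ i, g i (π i)

/-- The difference of two values of `d` is bounded by the `ℓ¹` norm of `d`. -/
lemma sub_le_sum_abs {L : Type*} [Fintype L] [DecidableEq L] (d : L → ℝ) (a b : L) :
    d b - d a ≤ ∑ l, |d l| := by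
  by_cases h : a = b
  · subst h
    simpa using Finset.sum_nonneg fun l _ => abs_nonneg (d l)
  · calc d b - d a ≤ |d a| + |d b| := by linarith [neg_abs_le (d a), le_abs_self (d b)]
      _ = ∑ l ∈ {a, b}, |d l| := by rw [Finset.sum_pair h]
      _ ≤ ∑ l, |d l| :=
        Finset.sum_le_sum_of_subset_of_nonneg (Finset.subset_univ _) fun l _ _ => abs_nonneg (d l)

/-- Changing the weights changes the difference of the values of two assignments by at most
the `ℓ¹` distance between the weights. -/
lemma assignVal_sub_sub_le {I L : Type*} [Fintype I] [Fintype L] [DecidableEq L]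
    (g g' : I → L → ℝ) (π ρ : I → L) :
    (assignVal g π - assignVal g ρ) - (assignVal g' π - assignVal g' ρ) ≤
      ∑ i, ∑ l, |g' i l - g i l| := by
  simp only [assignVal, ← Finset.sum_sub_distrib]
  refine Finset.sum_le_sum fun i _ => ?_
  have := sub_le_sum_abs (fun l => g' i l - g i l) (π i) (ρ i)
  linarith

/-- Let `Π_h` be the (nonempty) set of feasible assignments agreeing
with the default `ℓ` on every refugee with `y i = 1`. If every feasible assignment
maximizing value under `g'` lies in `Π_h`, then
`‖g' − g‖₁ ≥ V*(g) − max_{π ∈ Π_h} V_π(g)`. -/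
theorem harmless_modification_lower_bound {I L : Type*} [Fintype I] [Fintype L] [DecidableEq L]
    (c : L → ℕ) (g : I → L → ℝ) (ℓ : I → L) (y : I → ℕ) (hy : ∀ i, y i = 0 ∨ y i = 1)
    (hnonempty : ∃ π : I → L, Feasible c π ∧ ∀ i, y i = 1 → π i = ℓ i)
    (Vstar Vh : ℝ)
    (hV : IsGreatest {x | ∃ π : I → L, Feasible c π ∧ x = assignVal g π} Vstar)
    (hVh : IsGreatest {x | ∃ π : I → L,
        Feasible c π ∧ (∀ i, y i = 1 → π i = ℓ i) ∧ x = assignVal g π} Vh)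
    (g' : I → L → ℝ)
    (hg' : ∀ πhat : I → L, Feasible c πhat →
      (∀ π : I → L, Feasible c π → assignVal g' π ≤ assignVal g' πhat) →
      ∀ i, y i = 1 → πhat i = ℓ i) :
    Vstar - Vh ≤ ∑ i : I, ∑ l : L, |g' i l - g i l| := by
  obtain ⟨π₀, hπ₀, -⟩ := hnonempty
  obtain ⟨ρ, hρ, hmax⟩ :=
    Set.exists_max_image {π : I → L | Feasible c π} (assignVal g') (Set.toFinite _) ⟨π₀, hπ₀⟩
  obtain ⟨π, hπ, rfl⟩ := hV.1
  have h₁ : assignVal g ρ ≤ Vh := hVh.2 ⟨ρ, hρ, hg' ρ hρ hmax, rfl⟩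
  have h₂ : assignVal g' π ≤ assignVal g' ρ := hmax π hπ
  linarith [assignVal_sub_sub_le g g' π ρ]
end

section
/- Let I and L be finite sets, c : L → ℕ with ∑_{l ∈ L} c(l) = |I|, and g : I × L → ℝ with g(i,l) ≥ 0 for all i, l. Let ℓ : I → L be a default assignment and y : I → {0,1} realized outcomes, let Π_h be the set of feasible assignments π with π(i) = ℓ(i) for every i with y(i) = 1, and assume Π_h is nonempty. Then the infimum of ‖g' − g‖₁ over all weight functions g' : I × L → ℝ such that every feasible assignment maximizing V_·(g') lies in Π_h equals V*(g) − max_{π ∈ Π_h} V_π(g). (This is the optimal-value content of the paper's Theorem 1 on minimally modified predicted probabilities.) -/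
/-- If no permutation has positive weight under `A` and `A` vanishes on the diagonal, then no
closed walk has positive weight. -/
theorem sum_closed_walk_nonpos {I : Type*} [Fintype I] (A : I → I → ℝ)
    (hdiag : ∀ i, A i i = 0) (hperm : ∀ σ : Equiv.Perm I, ∑ i, A i (σ i) ≤ 0)
    (f : ℕ → I) (n : ℕ) (hf : f n = f 0) :
    ∑ t ∈ Finset.range n, A (f t) (f (t + 1)) ≤ 0 := by
  classical
  have hds : ∀ M ∈ doublyStochastic ℝ I, ∑ i, ∑ j, A i j * M i j ≤ 0 := by
    intro M hM
    obtain ⟨w, hw, -, rfl⟩ := exists_eq_sum_perm_of_mem_doublyStochastic hM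
    have key : ∑ i, ∑ j, A i j * (∑ σ : Equiv.Perm I, w σ • σ.permMatrix ℝ) i j
        = ∑ σ : Equiv.Perm I, w σ * ∑ i, A i (σ i) := by
      simp_rw [Matrix.sum_apply, Finset.mul_sum]
      rw [Finset.sum_comm' (t' := Finset.univ) (s' := fun _ => Finset.univ) (by simp)]
      rw [Finset.sum_congr rfl fun j _ => Finset.sum_comm, Finset.sum_comm]
      refine Finset.sum_congr rfl fun σ _ => ?_
      rw [Finset.sum_comm]
      refine Finset.sum_congr rfl fun i _ => ?_
      rw [Finset.sum_eq_single (σ i)]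
      · simp [Equiv.Perm.permMatrix, PEquiv.toMatrix_apply, mul_comm]
      · intro j _ hj
        simp [Equiv.Perm.permMatrix, PEquiv.toMatrix_apply, hj.symm]
      · simp
    rw [key]
    exact Finset.sum_nonpos fun σ _ => mul_nonpos_of_nonneg_of_nonpos (hw σ) (hperm σ)
  rcases Nat.eq_zero_or_pos n with rfl | hn
  · simp
  have hn' : (0 : ℝ) < n := by exact_mod_cast hn
  let r : I → ℝ := fun i => ∑ t ∈ Finset.range n, if f t = i then 1 else 0
  let N : I → I → ℝ := fun i j =>
    ∑ t ∈ Finset.range n, if f t = i then (if f (t + 1) = j then 1 else 0) else 0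
  have hr : ∀ i, r i ≤ n := fun i => by
    calc r i ≤ ∑ t ∈ Finset.range n, (1 : ℝ) :=
          Finset.sum_le_sum fun t _ => by split_ifs <;> norm_num
      _ = n := by simp
  have hN : ∀ i j, 0 ≤ N i j := fun i j =>
    Finset.sum_nonneg fun t _ => by split_ifs <;> norm_num
  have hrow : ∀ i, ∑ j, N i j = r i := fun i => by
    simp only [N, r]
    rw [Finset.sum_comm]
    refine Finset.sum_congr rfl fun t _ => ?_
    split_ifs <;> simp
  have hcol : ∀ j, ∑ i, N i j = r j := fun j => by
    simp only [N, r]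
    rw [Finset.sum_comm]
    have h1 : ∑ t ∈ Finset.range n, (if f (t + 1) = j then (1 : ℝ) else 0)
        = ∑ t ∈ Finset.range n, if f t = j then 1 else 0 := by
      have h2 := Finset.sum_range_succ (fun t => if f t = j then (1 : ℝ) else 0) n
      have h3 := Finset.sum_range_succ' (fun t => if f t = j then (1 : ℝ) else 0) n
      rw [hf] at h2
      linarith
    rw [← h1]
    exact Finset.sum_congr rfl fun t _ => by simp
  have hM : (Matrix.of fun i j => (n : ℝ)⁻¹ * (N i j + if i = j then n - r i else 0))
      ∈ doublyStochastic ℝ I := by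
    rw [mem_doublyStochastic_iff_sum]
    refine ⟨fun i j => ?_, fun i => ?_, fun j => ?_⟩
    · have := hN i j
      have := hr i
      simp only [Matrix.of_apply]
      refine mul_nonneg (by positivity) ?_
      split_ifs <;> linarith
    · simp only [Matrix.of_apply, ← Finset.mul_sum, Finset.sum_add_distrib, hrow]
      simp [hn'.ne']
    · simp only [Matrix.of_apply, ← Finset.mul_sum, Finset.sum_add_distrib, hcol]
      simp [hn'.ne']
  have h := hds _ hM
  have heq : ∑ i, ∑ j, A i j * ((n : ℝ)⁻¹ * (N i j + if i = j then n - r i else 0))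
      = (n : ℝ)⁻¹ * ∑ t ∈ Finset.range n, A (f t) (f (t + 1)) := by
    have h1 : ∀ i j, A i j * ((n : ℝ)⁻¹ * (N i j + if i = j then n - r i else 0))
        = (n : ℝ)⁻¹ * (A i j * N i j) := fun i j => by
      split_ifs with hij
      · subst hij; simp [hdiag]
      · ring
    simp_rw [h1, ← Finset.mul_sum]
    congr 1
    simp only [N, Finset.mul_sum]
    rw [Finset.sum_congr rfl fun i _ => Finset.sum_comm, Finset.sum_comm]
    refine Finset.sum_congr rfl fun t _ => ?_
    rw [Finset.sum_eq_single (f t)]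
    · simp
    · intro i _ hi
      simp [hi.symm]
    · simp
  simp only [Matrix.of_apply] at h
  rw [heq] at h
  exact nonpos_of_mul_nonpos_right h (by positivity)

/-- A weight on the complete digraph with no positive permutation is dominated by the
differences of a potential. -/
theorem exists_potential {I : Type*} [Fintype I] (A : I → I → ℝ)
    (hdiag : ∀ i, A i i = 0) (hperm : ∀ σ : Equiv.Perm I, ∑ i, A i (σ i) ≤ 0) :
    ∃ p : I → ℝ, ∀ i j, A i j ≤ p j - p i := by
  rcases isEmpty_or_nonempty I with hI | ⟨⟨r⟩⟩
  · exact ⟨fun _ => 0, fun i => isEmptyElim i⟩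
  let S : I → Set ℝ := fun j => {w | ∃ (f : ℕ → I) (n : ℕ), f 0 = r ∧ f n = j ∧
    w = ∑ t ∈ Finset.range n, A (f t) (f (t + 1))}
  have hext : ∀ j k w, w ∈ S j → w + A j k ∈ S k := by
    rintro j k w ⟨f, n, h0, hn, rfl⟩
    refine ⟨Function.update f (n + 1) k, n + 1, ?_, by simp, ?_⟩
    · rw [Function.update_of_ne (by omega), h0]
    · rw [Finset.sum_range_succ, Function.update_self, Function.update_of_ne (by omega), hn]
      congr 1
      refine Finset.sum_congr rfl fun t ht => ?_
      have := Finset.mem_range.mp ht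
      rw [Function.update_of_ne (by omega), Function.update_of_ne (by omega)]
  have hclosed : ∀ w ∈ S r, w ≤ 0 := by
    rintro w ⟨f, n, h0, hn, rfl⟩
    exact sum_closed_walk_nonpos A hdiag hperm f n (hn.trans h0.symm)
  have hne : ∀ j, (S j).Nonempty := fun j =>
    ⟨_, hext r j 0 ⟨fun _ => r, 0, rfl, rfl, by simp⟩⟩
  have hbdd : ∀ j, BddAbove (S j) := fun j =>
    ⟨-A j r, fun w hw => by linarith [hclosed _ (hext j r w hw)]⟩
  refine ⟨fun j => sSup (S j), fun i j => ?_⟩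
  have : sSup (S i) ≤ sSup (S j) - A i j :=
    csSup_le (hne i) fun w hw => by linarith [le_csSup (hbdd j) (hext i j w hw)]
  linarith

/-- When the total capacity equals the number of refugees, a feasible assignment fills every
location. -/
theorem Feasible.card_eq {I L : Type*} [Fintype I] [Fintype L] [DecidableEq L] {c : L → ℕ}
    (hc : ∑ l : L, c l = Fintype.card I) {π : I → L} (hπ : Feasible c π) (l : L) :
    (Finset.univ.filter fun i => π i = l).card = c l := by
  have h : ∑ l : L, (Finset.univ.filter fun i => π i = l).card = ∑ l : L, c l := by
    rw [hc, ← Finset.card_univ]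
    exact (Finset.card_eq_sum_card_fiberwise fun i _ => Finset.mem_coe.mpr (Finset.mem_univ _)).symm
  exact (Finset.sum_eq_sum_iff_of_le fun l _ => hπ l).mp h l (Finset.mem_univ l)

/-- When the total capacity equals the number of refugees, location prices collected by a
feasible assignment do not depend on the assignment. -/
theorem Feasible.sum_comp {I L : Type*} [Fintype I] [Fintype L] [DecidableEq L] {c : L → ℕ}
    (hc : ∑ l : L, c l = Fintype.card I) {π : I → L} (hπ : Feasible c π) (v : L → ℝ) :
    ∑ i, v (π i) = ∑ l, c l * v l := by
  rw [← Finset.sum_fiberwise Finset.univ π]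
  refine Finset.sum_congr rfl fun l _ => ?_
  rw [← hπ.card_eq hc l, ← nsmul_eq_mul]
  refine Finset.sum_eq_card_nsmul fun i hi => ?_
  rw [(Finset.mem_filter.mp hi).2]

/-- Reindexing the refugees preserves feasibility. -/
theorem Feasible.comp_perm {I L : Type*} [Fintype I] [DecidableEq L] {c : L → ℕ} {π : I → L}
    (hπ : Feasible c π) (σ : Equiv.Perm I) : Feasible c (π ∘ σ) := by
  intro l
  refine le_trans (Finset.card_le_card_of_injOn σ (fun i hi => ?_) σ.injective.injOn) (hπ l)
  simpa using hi

/-- Optimal dual prices for the assignment problem: `u` and `v` dominate the weights on all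
usable locations, with total price equal to the optimal value. -/
theorem exists_dual_prices {I L : Type*} [Fintype I] [Fintype L] [DecidableEq L] {c : L → ℕ}
    (hc : ∑ l : L, c l = Fintype.card I) (g : I → L → ℝ) {π : I → L} (hπ : Feasible c π)
    (hopt : ∀ ρ : I → L, Feasible c ρ → assignVal g ρ ≤ assignVal g π) :
    ∃ (u : I → ℝ) (v : L → ℝ), (∀ ρ : I → L, Feasible c ρ → ∀ i, g i (ρ i) ≤ u i + v (ρ i)) ∧
      ∀ ρ : I → L, Feasible c ρ → ∑ i, (u i + v (ρ i)) = assignVal g π := by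
  obtain ⟨p, hp⟩ := exists_potential (fun i j => g i (π j) - g i (π i)) (by simp) fun σ => by
    have := hopt _ (hπ.comp_perm σ)
    simp only [assignVal, Function.comp_apply] at this
    rw [Finset.sum_sub_distrib]
    linarith
  have hinv : ∀ i j, π i = π j → p i = p j := fun i j hij => by
    have h1 := hp i j
    have h2 := hp j i
    simp only [hij, sub_self] at h1 h2
    linarith
  let v : L → ℝ := Function.extend π p 0
  have hv : ∀ i, v (π i) = p i := fun i =>
    Function.FactorsThrough.extend_apply (fun {a b} hab => hinv a b hab) 0 i
  refine ⟨fun i => g i (π i) - p i, v, fun ρ hρ i => ?_, fun ρ hρ => ?_⟩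
  · obtain ⟨j, hj⟩ : ∃ j, π j = ρ i := by
      have hpos : 0 < (Finset.univ.filter fun j => π j = ρ i).card := by
        rw [hπ.card_eq hc, ← hρ.card_eq hc]
        exact Finset.card_pos.mpr ⟨i, by simp⟩
      obtain ⟨j, hj⟩ := Finset.card_pos.mp hpos
      exact ⟨j, (Finset.mem_filter.mp hj).2⟩
    rw [← hj, hv]
    linarith [hp i j]
  · rw [Finset.sum_add_distrib, hρ.sum_comp hc, ← hπ.sum_comp hc, ← Finset.sum_add_distrib]
    simp [hv, assignVal]

/-- If `ρ` is at least as good as `π` under modified weights, then under the original weights `π`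
exceeds `ρ` by at most the `L1` size of the modification. -/
theorem assignVal_sub_le_l1 {I L : Type*} [Fintype I] [Fintype L]
    (g g' : I → L → ℝ) (π ρ : I → L) (h : assignVal g' π ≤ assignVal g' ρ) :
    assignVal g π - assignVal g ρ ≤ ∑ i, ∑ l, |g' i l - g i l| := by
  classical
  have key : ∑ i, ((g i (π i) - g' i (π i)) - (g i (ρ i) - g' i (ρ i)))
      ≤ ∑ i, ∑ l, |g' i l - g i l| := by
    refine Finset.sum_le_sum fun i _ => ?_
    by_cases hi : π i = ρ i
    · rw [hi, sub_self]
      exact Finset.sum_nonneg fun l _ => abs_nonneg _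
    · have h2 := Finset.sum_le_sum_of_subset_of_nonneg (Finset.subset_univ {π i, ρ i})
        fun l _ _ => abs_nonneg (g' i l - g i l)
      rw [Finset.sum_pair hi] at h2
      linarith [neg_abs_le (g' i (π i) - g i (π i)), le_abs_self (g' i (ρ i) - g i (ρ i))]
  simp only [assignVal] at h ⊢
  simp only [Finset.sum_sub_distrib] at key
  linarith

/-- optimal-value content of Theorem 1. Let `Π_h` be the (nonempty)
set of feasible assignments agreeing with the default `ℓ` on every refugee with
`y i = 1`. The infimum of `‖g' − g‖₁` over weight functions `g'` such that *every*
feasible assignment maximizing value under `g'` lies in `Π_h` equals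
`V*(g) − max_{π ∈ Π_h} V_π(g)`. -/
theorem minimal_harmless_modification_value {I L : Type*} [Fintype I] [Fintype L] [DecidableEq L]
    (c : L → ℕ) (hc : ∑ l : L, c l = Fintype.card I)
    (g : I → L → ℝ) (hg : ∀ i l, 0 ≤ g i l)
    (ℓ : I → L) (y : I → ℕ) (hy : ∀ i, y i = 0 ∨ y i = 1)
    (hnonempty : ∃ π : I → L, Feasible c π ∧ ∀ i, y i = 1 → π i = ℓ i)
    (Vstar Vh : ℝ)
    (hV : IsGreatest {x | ∃ π : I → L, Feasible c π ∧ x = assignVal g π} Vstar)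
    (hVh : IsGreatest {x | ∃ π : I → L,
        Feasible c π ∧ (∀ i, y i = 1 → π i = ℓ i) ∧ x = assignVal g π} Vh) :
    IsGLB {d | ∃ g' : I → L → ℝ,
        (∀ πhat : I → L, Feasible c πhat →
          (∀ π : I → L, Feasible c π → assignVal g' π ≤ assignVal g' πhat) →
          ∀ i, y i = 1 → πhat i = ℓ i) ∧
        d = ∑ i : I, ∑ l : L, |g' i l - g i l|}
      (Vstar - Vh) := by
  classical
  obtain ⟨⟨πs, hπs, rfl⟩, hmax⟩ := hV
  obtain ⟨⟨πh, hπh, hharm, rfl⟩, hmaxh⟩ := hVh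
  constructor
  · rintro d ⟨g', hg', rfl⟩
    obtain ⟨πhat, hfeas, hbest⟩ := Set.exists_max_image {π : I → L | Feasible c π} (assignVal g')
      (Set.toFinite _) ⟨πh, hπh⟩
    have h1 := hmaxh ⟨πhat, hfeas, hg' πhat hfeas hbest, rfl⟩
    have h2 := assignVal_sub_le_l1 g g' πs πhat (hbest πs hπs)
    linarith
  · intro b hb
    obtain ⟨u, v, hdom, htot⟩ := exists_dual_prices hc g hπs fun ρ hρ => hmax ⟨ρ, hρ, rfl⟩
    refine le_of_forall_pos_le_add fun ε hε => ?_
    have hcard : (0 : ℝ) < Fintype.card I + 1 := by positivity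
    let δ : ℝ := ε / (Fintype.card I + 1)
    have hδ : 0 < δ := div_pos hε hcard
    let e : I → ℝ := fun i => if y i = 1 then δ else 0
    have he : ∀ i, 0 ≤ e i := fun i => by simp only [e]; split_ifs <;> linarith
    have hesum : ∑ i, e i ≤ ε := calc
      ∑ i, e i ≤ ∑ _i : I, δ := Finset.sum_le_sum fun i _ => by
          simp only [e]; split_ifs <;> linarith
      _ = Fintype.card I * δ := by simp
      _ ≤ (Fintype.card I + 1) * δ := by nlinarith
      _ = ε := mul_div_cancel₀ _ hcard.ne'
    let g' : I → L → ℝ := fun i l => if l = πh i then u i + v l + e i else g i l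
    have hdist : ∑ i, ∑ l, |g' i l - g i l|
        = assignVal g πs - assignVal g πh + ∑ i, e i := by
      rw [← htot πh hπh, assignVal, ← Finset.sum_sub_distrib, ← Finset.sum_add_distrib]
      refine Finset.sum_congr rfl fun i _ => ?_
      rw [Finset.sum_eq_single (πh i)]
      · simp only [g', if_true]
        rw [abs_of_nonneg (by linarith [hdom πh hπh i, he i])]
        ring
      · intro l _ hl
        simp [g', hl]
      · simp
    have hval : assignVal g' πh = assignVal g πs + ∑ i, e i := by
      rw [← htot πh hπh, ← Finset.sum_add_distrib]
      simp [assignVal, g']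
    refine (hb ⟨g', fun πhat hfeas hbest i hi => ?_, rfl⟩).trans (by rw [hdist]; linarith)
    rw [← hharm i hi]
    by_contra hne
    have hlt : assignVal g' πhat < ∑ j, (u j + v (πhat j) + e j) := by
      refine Finset.sum_lt_sum (fun j _ => ?_) ⟨i, Finset.mem_univ i, ?_⟩
      · simp only [g']
        split_ifs
        · exact le_rfl
        · linarith [hdom πhat hfeas j, he j]
      · have : e i = δ := if_pos hi
        simp only [g', if_neg hne]
        linarith [hdom πhat hfeas i]
    rw [Finset.sum_add_distrib, htot πhat hfeas] at hlt
    linarith [hbest πh hπh]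
end
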